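/- arXiv:math/0609436 — 3 statements merged into one kernel-verified Lean document; each statement's English description precedes it below -/
import Mathlib

section
/- Let f ∈ Mould(m), g ∈ Mould(n), h ∈ Mould(p) and let 1 ≤ i < j ≤ m. Then (f ∘_i g) ∘_{j+n−1} h = (f ∘_j h) ∘_i g in Mould(m+n+p−2). -/
/-!
Formalization of results from "The anticyclic operad of moulds" (F. Chapoton).

`Mould n` is the field of rational functions in variables `u 1, …, u n` with
rational coefficients, realized as a subfield of the fraction field `K` of
`ℚ[X 0, X 1, X 2, …]`.  The variable `u 0 = X 0` is reserved as an auxiliary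
variable (the parameter `t` or `λ`).  Substitution of rational functions for
the variables is realized by the (partial, well-defined) function `msub`.
-/

noncomputable section
namespace MouldOperad

open MvPolynomial Finset

attribute [local instance] Classical.propDecidable
set_option synthInstance.maxHeartbeats 1000000

abbrev MPoly : Type := MvPolynomial ℕ ℚ
abbrev K : Type := FractionRing MPoly

/-- the variable `u i` (1-based; index `0` is auxiliary). -/
def u (i : ℕ) : K := algebraMap MPoly K (X i)

/-- `u_{i..j} = u_i + u_{i+1} + ⋯ + u_j`. -/
def usum (i j : ℕ) : K := ∑ k ∈ Finset.Icc i j, u k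

/-- evaluation of polynomials, sending the variable `X k` to `v k`. -/
def pev (v : ℕ → K) : MPoly →+* K :=
  eval₂Hom ((algebraMap MPoly K).comp (C : ℚ →+* MPoly)) v

/-- Substitution of the rational functions `v k` for the variables of `f ∈ K`
(the induced field homomorphism): it takes the canonical value whenever `f` has
a fraction representation whose denominator does not vanish under the
substitution (this value does not depend on the representation), and the junk
value `0` otherwise. -/
def msub (v : ℕ → K) (f : K) : K :=
  if h : ∃ w : K, ∃ p q : MPoly, q ≠ 0 ∧
      f = algebraMap MPoly K p / algebraMap MPoly K q ∧
      pev v q ≠ 0 ∧ w = pev v p / pev v q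
  then h.choose else 0

/-- the field `Mould n` of rational functions in `u 1, …, u n`. -/
def Mould (n : ℕ) : Subfield K :=
  Subfield.closure {x : K | ∃ i, 1 ≤ i ∧ i ≤ n ∧ x = u i}

/-- substitution used for `f` in `f ∘_i g`, where `g` has degree `n`:
`f(u_1, …, u_{i-1}, u_{i..i+n-1}, u_{i+n}, …, u_{m+n-1})`. -/
def compSubF (n i : ℕ) : ℕ → K := fun k =>
  if k < i then u k else if k = i then usum i (i + n - 1) else u (k + n - 1)

/-- substitution used for `g` in `f ∘_i g` : `g(u_i, …, u_{i+n-1})`. -/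
def compSubG (i : ℕ) : ℕ → K := fun k => u (k + i - 1)

/-- the composition `f ∘_i g`, where `g` has degree `n` (1-based index `i`). -/
def comp (n i : ℕ) (f g : K) : K :=
  usum i (i + n - 1) * msub (compSubF n i) f * msub (compSubG i) g

/-- the push `τ` on `Mould n`: `τ(f)(u_1,…,u_n) = f(-u_{1..n}, u_1, …, u_{n-1})`. -/
def push (n : ℕ) (f : K) : K :=
  msub (fun k => if k = 1 then -(usum 1 n) else if k ≤ n then u (k - 1) else u k) f

/-- a permutation of `Fin n` as a (1-based) permutation of `ℕ`. -/
def permExt (n : ℕ) (σ : Equiv.Perm (Fin n)) : ℕ → ℕ := fun k =>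
  if h : 1 ≤ k ∧ k ≤ n then ((σ ⟨k - 1, by omega⟩ : Fin n) : ℕ) + 1 else k

/-- `f ∈ Mould n` is alternal : for each `1 ≤ i ≤ n-1`, the sum of
`f(u_{σ(1)}, …, u_{σ(n)})` over the shuffles `σ ∈ Sh(i, n-i)` vanishes. -/
def IsAlternal (n : ℕ) (f : K) : Prop :=
  ∀ i : ℕ, 1 ≤ i → i ≤ n - 1 →
    ∑ σ ∈ Finset.univ.filter (fun σ : Equiv.Perm (Fin n) =>
        (∀ a b : Fin n, a < b → (b : ℕ) < i → σ a < σ b) ∧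
        (∀ a b : Fin n, a < b → i ≤ (a : ℕ) → σ a < σ b)),
      msub (fun k => u (permExt n σ k)) f = 0

/-- `f ∈ Mould n` is vegetal :
`u_1⋯u_n · Σ_{σ ∈ S_n} f(t·u_{σ(1)}, …, t·u_{σ(n)}) = n! · f(t,…,t)`,
where the auxiliary variable `t` is `u 0`. -/
def IsVegetal (n : ℕ) (f : K) : Prop :=
  (∏ k ∈ Finset.Icc 1 n, u k) *
      ∑ σ : Equiv.Perm (Fin n), msub (fun k => u 0 * u (permExt n σ k)) f =
    (n.factorial : K) * msub (fun _ => u 0) f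

/-- `f ∈ Mould n` is homogeneous of weight `d` : `f(λu_1,…,λu_n) = λ^d·f`,
where the auxiliary variable `λ` is `u 0`. -/
def IsHomogeneousOfWeight (n : ℕ) (d : ℤ) (f : K) : Prop :=
  msub (fun k => if 1 ≤ k ∧ k ≤ n then u 0 * u k else u k) f = u 0 ^ d * f

/-- shift substitution : `g(u_{m+1}, …, u_{m+n})`. -/
def shiftSub (m : ℕ) : ℕ → K := fun k => u (k + m)

/-- `f ≻ g` for `f ∈ Mould m`, `g ∈ Mould n`. -/
def dsucc (m n : ℕ) (f g : K) : K :=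
  f * msub (shiftSub m) g * usum (m + 1) (m + n) / usum 1 (m + n)

/-- `f ≺ g` for `f ∈ Mould m`, `g ∈ Mould n`. -/
def dprec (m n : ℕ) (f g : K) : K :=
  f * msub (shiftSub m) g * usum 1 m / usum 1 (m + n)

/-- `MU(f,g)` for `f ∈ Mould m`. -/
def MU (m : ℕ) (f g : K) : K := f * msub (shiftSub m) g

/-- `LIMU(f,g) = MU(f,g) - MU(g,f)` for `f ∈ Mould m`, `g ∈ Mould n`. -/
def LIMU (m n : ℕ) (f g : K) : K := MU m f g - MU n g f

/-- the pre-Lie product `f ↶ g` for `f ∈ Mould m`, `g ∈ Mould n`. -/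
def preLieCurve (m n : ℕ) (f g : K) : K :=
  f * msub (shiftSub m) g * usum (m + 1) (m + n) / usum 1 (m + n)
    - g * msub (shiftSub n) f * usum 1 n / usum 1 (m + n)

/-- the pre-Lie product `f ∘ g = Σ_{i=1}^m f ∘_i g`, `f ∈ Mould m`, `g ∈ Mould n`. -/
def preLieComp (m n : ℕ) (f g : K) : K := ∑ i ∈ Finset.Icc 1 m, comp n i f g

/-- `H_n = ∏_{1 ≤ i ≤ j ≤ n} u_{i..j}`. -/
def Hprod (n : ℕ) : K := ∏ i ∈ Finset.Icc 1 n, ∏ j ∈ Finset.Icc i n, usum i j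

/-- `x` is (the image of) a polynomial in `u_1, …, u_n`. -/
def IsPolyIn (n : ℕ) (x : K) : Prop :=
  ∃ p : MPoly, (∀ k ∈ p.vars, 1 ≤ k ∧ k ≤ n) ∧ x = algebraMap MPoly K p

/-- `f ∈ Mould n` has nice poles: it is a polynomial divided by a product of
powers of the linear forms `u_{i..j}`, `1 ≤ i ≤ j ≤ n`. -/
def HasNicePoles (n : ℕ) (f : K) : Prop :=
  ∃ (P : MPoly) (e : ℕ → ℕ → ℕ),
    (∀ k ∈ P.vars, 1 ≤ k ∧ k ≤ n) ∧
    f = algebraMap MPoly K P /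
        ∏ i ∈ Finset.Icc 1 n, ∏ j ∈ Finset.Icc i n, usum i j ^ e i j

/-- the Over product `f / Y`, `f ∈ Mould n`. -/
def overY (n : ℕ) (f : K) : K := f / usum 1 (n + 1)

/-- the Under product `Y \ f`, `f ∈ Mould n`. -/
def underY (n : ℕ) (f : K) : K := msub (fun k => u (k + 1)) f / usum 1 (n + 1)

/-- `ARIT(f,g) = f ∘ (g/Y) - f ∘ (Y\g)` for `f ∈ Mould m`, `g ∈ Mould n`. -/
def ARIT (m n : ℕ) (f g : K) : K :=
  preLieComp m (n + 1) f (overY n g) - preLieComp m (n + 1) f (underY n g)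

/-- `ARI(f,g) = ARIT(f,g) - ARIT(g,f) + LIMU(f,g)`, `f ∈ Mould m`, `g ∈ Mould n`. -/
def ARI (m n : ℕ) (f g : K) : K := ARIT m n f g - ARIT n m g f + LIMU m n f g

/-- evaluation of polynomials into `RatFunc K` (rational functions in `t` over `K`). -/
def pevR (v : ℕ → RatFunc K) : MPoly →+* RatFunc K :=
  eval₂Hom ((RatFunc.C).comp ((algebraMap MPoly K).comp (C : ℚ →+* MPoly))) v

/-- substitution into `RatFunc K`. -/
def msubR (v : ℕ → RatFunc K) (f : K) : RatFunc K :=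
  if h : ∃ w : RatFunc K, ∃ p q : MPoly, q ≠ 0 ∧
      f = algebraMap MPoly K p / algebraMap MPoly K q ∧
      pevR v q ≠ 0 ∧ w = pevR v p / pevR v q
  then h.choose else 0

/-- residue at `t = 0`: the coefficient of `t⁻¹` in the Laurent expansion at `0`. -/
def res (r : RatFunc K) : K := (↑r : LaurentSeries K).coeff (-1)

/-- the mould derivative `∂f` for `f ∈ Mould m`:
`∂f(u_1,…,u_{m-1}) = Σ_{j=1}^m Res_{t=0} f(u_1,…,u_{j-1},t,u_j,…,u_{m-1})`,
where `f(u_1,…,u_{j-1},t,u_j,…,u_{m-1})` is viewed in `RatFunc K`. -/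
def mderiv (m : ℕ) (f : K) : K :=
  ∑ j ∈ Finset.Icc 1 m,
    res (msubR (fun k =>
      if k < j then RatFunc.C (u k)
      else if k = j then RatFunc.X
      else RatFunc.C (u (k - 1))) f)

/-- evaluation of polynomials into `ℚ(x)`, sending every variable to `1/x`. -/
def pevX : MPoly →+* RatFunc ℚ :=
  eval₂Hom (RatFunc.C : ℚ →+* RatFunc ℚ) (fun _ => (RatFunc.X)⁻¹)

/-- the substitution `u_i ↦ 1/x`, landing in `ℚ(x)`. -/
def evalx (f : K) : RatFunc ℚ :=
  if h : ∃ w : RatFunc ℚ, ∃ p q : MPoly, q ≠ 0 ∧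
      f = algebraMap MPoly K p / algebraMap MPoly K q ∧
      pevX q ≠ 0 ∧ w = pevX p / pevX q
  then h.choose else 0

/-- the derivative `d/dx` on `ℚ(x)`. -/
def rfDeriv (r : RatFunc ℚ) : RatFunc ℚ :=
  (algebraMap (Polynomial ℚ) (RatFunc ℚ) (Polynomial.derivative r.num) *
      algebraMap (Polynomial ℚ) (RatFunc ℚ) r.denom -
    algebraMap (Polynomial ℚ) (RatFunc ℚ) r.num *
      algebraMap (Polynomial ℚ) (RatFunc ℚ) (Polynomial.derivative r.denom)) /
    algebraMap (Polynomial ℚ) (RatFunc ℚ) r.denom ^ 2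
/-- If `pev v` is injective, then `msub v` is the induced homomorphism of fraction fields. -/
theorem msub_eq_lift {v : ℕ → K} (hv : Function.Injective (pev v)) (f : K) :
    msub v f = IsFractionRing.lift hv f := by
  have key : ∀ p q : MPoly, IsFractionRing.lift hv
      (algebraMap MPoly K p / algebraMap MPoly K q) = pev v p / pev v q := by
    intro p q
    rw [map_div₀, IsFractionRing.lift_algebraMap, IsFractionRing.lift_algebraMap]
  have hex : ∃ w : K, ∃ p q : MPoly, q ≠ 0 ∧
      f = algebraMap MPoly K p / algebraMap MPoly K q ∧
      pev v q ≠ 0 ∧ w = pev v p / pev v q := by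
    obtain ⟨p, q, hq, rfl⟩ := IsFractionRing.div_surjective (A := MPoly) f
    have hq0 : q ≠ 0 := nonZeroDivisors.ne_zero hq
    exact ⟨_, p, q, hq0, rfl, (map_ne_zero_iff _ hv).2 hq0, rfl⟩
  rw [msub, dif_pos hex]
  obtain ⟨p, q, -, hf, -, hw⟩ := hex.choose_spec
  rw [hw, ← key, ← hf]

/-- `msub v` is a ring homomorphism with `u k ↦ v k` as soon as `v` consists of polynomials
and the corresponding polynomial substitution has a left inverse. -/
theorem exists_ringHom_msub (v : ℕ → K) (P Q : ℕ → MPoly)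
    (hP : ∀ k, v k = algebraMap MPoly K (P k)) (hQ : ∀ k, aeval Q (P k) = X k) :
    ∃ φ : K →+* K, (∀ f, msub v f = φ f) ∧ ∀ k, φ (u k) = v k := by
  have hpev : ∀ x, pev v x = algebraMap MPoly K (aeval P x) := by
    intro x
    induction x using MvPolynomial.induction_on with
    | C a =>
      rw [pev, coe_eval₂Hom, eval₂_C, algHom_C, RingHom.comp_apply]
      rfl
    | add p q hp hq => rw [map_add, map_add, map_add, hp, hq]
    | mul_X p k hp =>
      rw [map_mul, map_mul, map_mul, hp]
      simp [pev, hP]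
  have hleft : Function.LeftInverse (aeval Q) (aeval P : MPoly →ₐ[ℚ] MPoly) := by
    intro x
    have : (aeval Q).comp (aeval P : MPoly →ₐ[ℚ] MPoly) = AlgHom.id ℚ MPoly := by
      ext k : 1
      rw [AlgHom.comp_apply, aeval_X, hQ, AlgHom.id_apply]
    exact DFunLike.congr_fun this x
  have hinj : Function.Injective (pev v) := by
    intro x y hxy
    rw [hpev, hpev] at hxy
    exact hleft.injective (IsFractionRing.injective MPoly K hxy)
  refine ⟨IsFractionRing.lift hinj, msub_eq_lift hinj, fun k => ?_⟩
  rw [u, IsFractionRing.lift_algebraMap]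
  simp [pev]

theorem exists_ringHom_compSubG (i : ℕ) (hi : 1 ≤ i) :
    ∃ φ : K →+* K, (∀ f, msub (compSubG i) f = φ f) ∧ ∀ k, φ (u k) = u (k + i - 1) := by
  refine exists_ringHom_msub (compSubG i) (fun k => X (k + i - 1)) (fun k => X (k + 1 - i))
    (fun k => rfl) (fun k => ?_)
  rw [aeval_X]
  congr 1
  omega

theorem exists_ringHom_compSubF (n i : ℕ) (hn : 1 ≤ n) :
    ∃ φ : K →+* K, (∀ f, msub (compSubF n i) f = φ f) ∧
      (∀ k < i, φ (u k) = u k) ∧ φ (u i) = usum i (i + n - 1) ∧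
      ∀ k, i < k → φ (u k) = u (k + n - 1) := by
  obtain ⟨φ, hφ, hu⟩ := exists_ringHom_msub (compSubF n i)
    (fun k => if k < i then X k else if k = i then ∑ l ∈ Finset.Icc i (i + n - 1), X l
      else X (k + n - 1))
    (fun k => if k ≤ i then X k else if k < i + n then 0 else X (k + 1 - n))
    (fun k => by
      simp only [compSubF, usum, u]
      split_ifs <;> simp)
    (fun k => by
      rcases lt_trichotomy k i with h | rfl | h
      · simp [h, h.le]
      · simp only [lt_irrefl, if_false, if_true, map_sum, aeval_X]
        rw [Finset.sum_eq_single k]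
        · simp
        · intro l hl hlk
          rw [Finset.mem_Icc] at hl
          rw [if_neg (by omega), if_pos (by omega)]
        · intro hk
          exact absurd (Finset.mem_Icc.2 ⟨le_rfl, by omega⟩) hk
      · rw [if_neg (by omega), if_neg (by omega), aeval_X, if_neg (by omega),
          if_neg (by omega)]
        congr 1
        omega)
  refine ⟨φ, hφ, fun k hk => ?_, ?_, fun k hk => ?_⟩
  · rw [hu, compSubF, if_pos hk]
  · rw [hu, compSubF, if_neg (lt_irrefl i), if_pos rfl]
  · rw [hu, compSubF, if_neg (by omega), if_neg (by omega)]

/-- Ring homomorphisms agreeing on `u 1, …, u n` agree on `Mould n`. -/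
theorem ringHom_eqOn_mould {n : ℕ} {φ ψ : K →+* K}
    (h : ∀ k, 1 ≤ k → k ≤ n → φ (u k) = ψ (u k)) {f : K} (hf : f ∈ Mould n) : φ f = ψ f := by
  refine RingHom.eqOn_field_closure (f := φ) (g := ψ) ?_ hf
  rintro _ ⟨k, h1, h2, rfl⟩
  exact h k h1 h2

theorem map_usum_of_fixed {φ : K →+* K} {a b : ℕ} (h : ∀ k, a ≤ k → k ≤ b → φ (u k) = u k) :
    φ (usum a b) = usum a b := by
  rw [usum, map_sum]
  exact Finset.sum_congr rfl fun k hk => h k (Finset.mem_Icc.1 hk).1 (Finset.mem_Icc.1 hk).2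

theorem map_usum_of_shift {φ : K →+* K} {a b d : ℕ}
    (h : ∀ k, a ≤ k → k ≤ b → φ (u k) = u (k + d)) :
    φ (usum a b) = usum (a + d) (b + d) := by
  rw [usum, usum, map_sum, ← Finset.map_add_right_Icc, Finset.sum_map]
  exact Finset.sum_congr rfl fun k hk => h k (Finset.mem_Icc.1 hk).1 (Finset.mem_Icc.1 hk).2

/-- for `f ∈ Mould m`, `g ∈ Mould n`, `h ∈ Mould p` and
`1 ≤ i < j ≤ m`, one has `(f ∘_i g) ∘_{j+n-1} h = (f ∘_j h) ∘_i g`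
in `Mould (m+n+p-2)`. -/
theorem comp_assoc_parallel (m n p : ℕ) (hm : 1 ≤ m) (hn : 1 ≤ n) (hp : 1 ≤ p)
    (f g h : K) (hf : f ∈ Mould m) (hg : g ∈ Mould n) (hh : h ∈ Mould p)
    (i j : ℕ) (hi : 1 ≤ i) (hij : i < j) (hjm : j ≤ m) :
    comp p (j + n - 1) (comp n i f g) h = comp n i (comp p j f h) g := by
  obtain ⟨n, rfl⟩ : ∃ d, n = d + 1 := ⟨n - 1, by omega⟩
  have hjn : j + (n + 1) - 1 = j + n := rfl
  obtain ⟨φ, hφ, φlt, φeq, φgt⟩ := exists_ringHom_compSubF (n + 1) i hn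
  obtain ⟨χ, hχ, χlt, χeq, χgt⟩ := exists_ringHom_compSubF p j hp
  obtain ⟨ω, hω, ωlt, ωeq, ωgt⟩ := exists_ringHom_compSubF p (j + n) hp
  obtain ⟨α, hα, αu⟩ := exists_ringHom_compSubG i hi
  obtain ⟨β, hβ, βu⟩ := exists_ringHom_compSubG j (by omega)
  obtain ⟨γ, hγ, γu⟩ := exists_ringHom_compSubG (j + n) (by omega)
  have shift_usum : φ (usum j (j + p - 1)) = usum (j + n) (j + n + p - 1) := by
    rw [map_usum_of_shift (d := n) fun k hk _ => φgt k (by omega)]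
    congr 1
    omega
  have fixed_usum : ω (usum i (i + n)) = usum i (i + n) :=
    map_usum_of_fixed fun k _ hk => ωlt k (by omega)
  have hf' : ω (φ f) = φ (χ f) := by
    refine ringHom_eqOn_mould (φ := ω.comp φ) (ψ := φ.comp χ) (fun k _ _ => ?_) hf
    simp only [RingHom.comp_apply]
    rcases lt_trichotomy k i with h | rfl | h
    · rw [χlt k (by omega), φlt k h, ωlt k (by omega)]
    · rw [χlt k hij, φeq]
      exact fixed_usum
    · rw [φgt k h]
      rcases lt_trichotomy k j with h' | rfl | h'
      · rw [χlt k h', φgt k h, ωlt _ (by omega)]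
      · rw [χeq, shift_usum]
        exact ωeq
      · rw [χgt k h', φgt _ (by omega), ωgt _ (by omega)]
        congr 1
        omega
  have hg' : ω (α g) = α g := by
    refine ringHom_eqOn_mould (φ := ω.comp α) (ψ := α) (fun k _ _ => ?_) hg
    rw [RingHom.comp_apply, αu, ωlt _ (by omega)]
  have hh' : φ (β h) = γ h := by
    refine ringHom_eqOn_mould (φ := φ.comp β) (ψ := γ) (fun k _ _ => ?_) hh
    rw [RingHom.comp_apply, βu, γu, φgt _ (by omega)]
    congr 1
    omega
  rw [hjn]
  simp only [comp, hφ, hχ, hω, hα, hβ, hγ, map_mul, hf', hg', hh', shift_usum]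
  rw [show i + (n + 1) - 1 = i + n from rfl, fixed_usum]
  ring

end MouldOperad
end
end

section
/- Let f ∈ Mould(m), g ∈ Mould(n), h ∈ Mould(p) and let 1 ≤ i ≤ m, 1 ≤ j ≤ n. Then f ∘_i (g ∘_j h) = (f ∘_i g) ∘_{i+j−1} h in Mould(m+n+p−2). -/
/-!
Formalization of results from "The anticyclic operad of moulds" (F. Chapoton).

`Mould n` is the field of rational functions in variables `u 1, …, u n` with
rational coefficients, realized as a subfield of the fraction field `K` of
`ℚ[X 0, X 1, X 2, …]`.  The variable `u 0 = X 0` is reserved as an auxiliary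
variable (the parameter `t` or `λ`).  Substitution of rational functions for
the variables is realized by the (partial, well-defined) function `msub`.
-/

noncomputable section
namespace MouldOperad

open MvPolynomial Finset

attribute [local instance] Classical.propDecidable
set_option synthInstance.maxHeartbeats 1000000

/-- If the variables substituted by `v` are algebraically independent, `msub v` is the
field endomorphism induced by `v`. -/
def msubHom (v : ℕ → K) (hv : Function.Injective (pev v)) : K →+* K :=
  IsFractionRing.lift hv

theorem msub_eq_msubHom (v : ℕ → K) (hv : Function.Injective (pev v)) (f : K) :
    msub v f = msubHom v hv f := by
  have key : ∀ p q : MPoly, f = algebraMap MPoly K p / algebraMap MPoly K q →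
      pev v p / pev v q = msubHom v hv f := by
    rintro p q rfl
    simp [msubHom]
  have hex : ∃ w : K, ∃ p q : MPoly, q ≠ 0 ∧
      f = algebraMap MPoly K p / algebraMap MPoly K q ∧
      pev v q ≠ 0 ∧ w = pev v p / pev v q := by
    obtain ⟨p, q, hq, hf⟩ := IsFractionRing.div_surjective (A := MPoly) f
    have hq0 : q ≠ 0 := nonZeroDivisors.ne_zero hq
    exact ⟨_, p, q, hq0, hf.symm, (map_ne_zero_iff _ hv).mpr hq0, rfl⟩
  unfold msub
  rw [dif_pos hex]
  obtain ⟨p, q, -, hf, -, hw⟩ := hex.choose_spec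
  rw [hw, key p q hf]

theorem msubHom_u (v : ℕ → K) (hv : Function.Injective (pev v)) (k : ℕ) :
    msubHom v hv (u k) = v k := by
  simp [msubHom, u, pev]

theorem msubHom_usum (v : ℕ → K) (hv : Function.Injective (pev v)) (a b : ℕ) :
    msubHom v hv (usum a b) = ∑ k ∈ Finset.Icc a b, v k := by
  simp [usum, msubHom_u]

theorem ringHom_ext_u {φ ψ : K →+* K} (h : ∀ k, φ (u k) = ψ (u k)) : φ = ψ := by
  refine IsLocalization.ringHom_ext (nonZeroDivisors MPoly) ?_
  refine MvPolynomial.ringHom_ext (fun r => ?_) h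
  exact DFunLike.congr_fun (Subsingleton.elim
    ((φ.comp (algebraMap MPoly K)).comp C) ((ψ.comp (algebraMap MPoly K)).comp C)) r

theorem pev_injective_of_leftInverse (v : ℕ → K) (w r : ℕ → MPoly)
    (hv : ∀ k, v k = algebraMap MPoly K (w k)) (hr : ∀ k, aeval r (w k) = X k) :
    Function.Injective (pev v) := by
  have hpev : pev v = (algebraMap MPoly K).comp (aeval w : MPoly →ₐ[ℚ] MPoly).toRingHom := by
    refine MvPolynomial.ringHom_ext (fun c => ?_) (fun k => ?_)
    · simp only [pev, coe_eval₂Hom, eval₂_C, RingHom.comp_apply]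
      exact congrArg _ (aeval_C w c).symm
    · simp [pev, hv]
  have hleft : Function.LeftInverse (aeval r : MPoly →ₐ[ℚ] MPoly) (aeval w) := by
    have : (aeval r : MPoly →ₐ[ℚ] MPoly).comp (aeval w) = AlgHom.id ℚ MPoly :=
      MvPolynomial.algHom_ext (fun k => by
        rw [AlgHom.comp_apply, aeval_X, hr, AlgHom.id_apply])
    exact DFunLike.congr_fun this
  rw [hpev]
  exact (IsFractionRing.injective MPoly K).comp hleft.injective

theorem pev_compSubG_injective {i : ℕ} (hi : 1 ≤ i) :
    Function.Injective (pev (compSubG i)) := by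
  refine pev_injective_of_leftInverse _ (fun k => X (k + i - 1)) (fun k => X (k + 1 - i))
    (fun k => rfl) (fun k => ?_)
  rw [aeval_X]
  congr 1
  omega

theorem pev_compSubF_injective {n : ℕ} (hn : 1 ≤ n) (i : ℕ) :
    Function.Injective (pev (compSubF n i)) := by
  refine pev_injective_of_leftInverse _
    (fun k => if k < i then X k else
      if k = i then ∑ l ∈ Finset.Icc i (i + n - 1), X l else X (k + n - 1))
    (fun k => if k ≤ i then X k else if k < i + n then 0 else X (k + 1 - n))
    (fun k => ?_) (fun k => ?_)
  · unfold compSubF usum u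
    split_ifs <;> simp
  · split_ifs with h1 h2
    · simp [h1.le]
    · subst h2
      rw [map_sum, Finset.sum_eq_single_of_mem k (by simp; omega)]
      · simp
      · intro l hl hlk
        rw [Finset.mem_Icc] at hl
        rw [aeval_X, if_neg (by omega), if_pos (by omega)]
    · rw [aeval_X, if_neg (by omega), if_neg (by omega)]
      congr 1
      omega

theorem sum_compSubG {i : ℕ} (hi : 1 ≤ i) (a b : ℕ) :
    ∑ k ∈ Finset.Icc a b, compSubG i k = usum (a + i - 1) (b + i - 1) := by
  obtain ⟨c, rfl⟩ := Nat.exists_eq_add_of_le' hi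
  simp only [compSubG, usum, Nat.add_succ_sub_one]
  rw [← Finset.map_add_right_Icc, Finset.sum_map]
  rfl

theorem sum_compSubF {n : ℕ} (hn : 1 ≤ n) {a i b : ℕ} (hai : a ≤ i) (hib : i ≤ b) :
    ∑ k ∈ Finset.Icc a b, compSubF n i k = usum a (b + n - 1) := by
  induction b, hib using Nat.le_induction with
  | base =>
    have hIcc : ∀ c d : ℕ, Finset.Icc c d = Finset.Ico c (d + 1) := fun c d => by
      ext; simp
    rw [hIcc, Finset.sum_Ico_succ_top hai]
    have hlt : ∑ k ∈ Finset.Ico a i, compSubF n i k = ∑ k ∈ Finset.Ico a i, u k :=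
      Finset.sum_congr rfl fun k hk => by simp [compSubF, (Finset.mem_Ico.mp hk).2]
    rw [hlt]
    simp only [compSubF, lt_irrefl, if_false, if_true, usum, hIcc]
    exact Finset.sum_Ico_consecutive _ hai (by omega)
  | succ b hib ih =>
    rw [Finset.sum_Icc_succ_top (by omega), ih]
    have h : b + 1 + n - 1 = b + n - 1 + 1 := by omega
    rw [compSubF, if_neg (by omega), if_neg (by omega), h, usum, usum,
      Finset.sum_Icc_succ_top (by omega)]

/-- for `f ∈ Mould m`, `g ∈ Mould n`, `h ∈ Mould p` and
`1 ≤ i ≤ m`, `1 ≤ j ≤ n`, one has `f ∘_i (g ∘_j h) = (f ∘_i g) ∘_{i+j-1} h`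
in `Mould (m+n+p-2)`. -/
theorem comp_assoc_nested (m n p : ℕ) (hm : 1 ≤ m) (hn : 1 ≤ n) (hp : 1 ≤ p)
    (f g h : K) (hf : f ∈ Mould m) (hg : g ∈ Mould n) (hh : h ∈ Mould p)
    (i j : ℕ) (hi : 1 ≤ i) (him : i ≤ m) (hj : 1 ≤ j) (hjn : j ≤ n) :
    comp (n + p - 1) i f (comp p j g h) = comp p (i + j - 1) (comp n i f g) h := by
  have hij : 1 ≤ i + j - 1 := by omega
  have hnp : 1 ≤ n + p - 1 := by omega
  have hG := fun {l : ℕ} (hl : 1 ≤ l) => pev_compSubG_injective hl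
  have hF := fun {l : ℕ} (hl : 1 ≤ l) => pev_compSubF_injective hl
  have hGG : (msubHom _ (hG hi)).comp (msubHom _ (hG hj)) = msubHom _ (hG hij) := by
    refine ringHom_ext_u fun k => ?_
    simp only [RingHom.comp_apply, msubHom_u]
    rw [compSubG, msubHom_u, compSubG, compSubG]
    congr 1
    omega
  have hFG : (msubHom _ (hF hp (i + j - 1))).comp (msubHom _ (hG hi)) =
      (msubHom _ (hG hi)).comp (msubHom _ (hF hp j)) := by
    refine ringHom_ext_u fun k => ?_
    simp only [RingHom.comp_apply, msubHom_u]
    rw [compSubG, msubHom_u]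
    rcases lt_trichotomy k j with h | h | h
    · rw [compSubF, compSubF, if_pos (by omega), if_pos h, msubHom_u, compSubG]
    · rw [compSubF, compSubF, if_neg (by omega), if_pos (by omega), if_neg (by omega),
        if_pos h, msubHom_usum, sum_compSubG hi]
      congr 1 <;> omega
    · rw [compSubF, compSubF, if_neg (by omega), if_neg (by omega), if_neg (by omega),
        if_neg (by omega), msubHom_u, compSubG]
      congr 1
      omega
  have hFF : (msubHom _ (hF hp (i + j - 1))).comp (msubHom _ (hF hn i)) =
      msubHom _ (hF hnp i) := by
    refine ringHom_ext_u fun k => ?_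
    simp only [RingHom.comp_apply, msubHom_u]
    rcases lt_trichotomy k i with h | h | h
    · rw [compSubF, compSubF, if_pos h, if_pos h, msubHom_u, compSubF, if_pos (by omega)]
    · rw [compSubF, compSubF, if_neg (by omega), if_pos h, if_neg (by omega), if_pos h,
        msubHom_usum, sum_compSubF hp (by omega) (by omega)]
      congr 1
      omega
    · rw [compSubF, compSubF, if_neg (by omega), if_neg (by omega), if_neg (by omega),
        if_neg (by omega), msubHom_u, compSubF, if_neg (by omega), if_neg (by omega)]
      congr 1
      omega
  simp only [comp, msub_eq_msubHom _ (hG hi), msub_eq_msubHom _ (hG hj),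
    msub_eq_msubHom _ (hG hij), msub_eq_msubHom _ (hF hnp i), msub_eq_msubHom _ (hF hp j),
    msub_eq_msubHom _ (hF hp (i + j - 1)), msub_eq_msubHom _ (hF hn i), map_mul]
  simp only [← RingHom.comp_apply, hGG, hFF, hFG]
  rw [msubHom_usum, msubHom_usum, sum_compSubG hi, sum_compSubF hp (by omega) (by omega)]
  have e1 : i + (n + p - 1) - 1 = i + n - 1 + p - 1 := by omega
  have e2 : j + i - 1 = i + j - 1 := by omega
  have e3 : j + p - 1 + i - 1 = i + j - 1 + p - 1 := by omega
  rw [e1, e2, e3]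
  ring

end MouldOperad
end
end

section
/- For n ≥ 1 set H_n = ∏_{1 ≤ i ≤ j ≤ n} u_{i..j} ∈ ℚ[u_1,…,u_n]. If f ∈ Mould(m) and g ∈ Mould(n) are such that H_m·f and H_n·g are polynomials, then H_{m+n−1}·(f ∘_i g) is a polynomial for every 1 ≤ i ≤ m; moreover, if H_m·f is a polynomial then so is H_m·τ(f). -/
/-!
Formalization of results from "The anticyclic operad of moulds" (F. Chapoton).

`Mould n` is the field of rational functions in variables `u 1, …, u n` with
rational coefficients, realized as a subfield of the fraction field `K` of
`ℚ[X 0, X 1, X 2, …]`.  The variable `u 0 = X 0` is reserved as an auxiliary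
variable (the parameter `t` or `λ`).  Substitution of rational functions for
the variables is realized by the (partial, well-defined) function `msub`.
-/

noncomputable section
namespace MouldOperad

open MvPolynomial Finset

attribute [local instance] Classical.propDecidable
set_option synthInstance.maxHeartbeats 1000000

/-- the partial sum `u_0 + ⋯ + u_{k-1}`. -/
def partialSum (k : ℕ) : K := ∑ j ∈ Finset.range k, u j

/-- the linear form `u_x + ⋯ + u_{y-1}` attached to a pair `p = (x, y)`. -/
def pairForm (p : ℕ × ℕ) : K := partialSum p.2 - partialSum p.1

/-- the pairs `(x, y)` with `1 ≤ x < y ≤ n + 1`. -/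
def orderedPairs (n : ℕ) : Finset (ℕ × ℕ) :=
  (Finset.Icc 1 (n + 1) ×ˢ Finset.Icc 1 (n + 1)).filter (fun p => p.1 < p.2)

lemma mem_orderedPairs {n : ℕ} {p : ℕ × ℕ} :
    p ∈ orderedPairs n ↔ 1 ≤ p.1 ∧ p.1 < p.2 ∧ p.2 ≤ n + 1 := by
  simp only [orderedPairs, Finset.mem_filter, Finset.mem_product, Finset.mem_Icc]
  omega

lemma sum_Icc_sub_of_le (R : ℕ → K) {a b : ℕ} (h : a ≤ b + 1) :
    ∑ k ∈ Finset.Icc a b, (R (k + 1) - R k) = R (b + 1) - R a := by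
  rw [← Finset.Ico_add_one_right_eq_Icc, Finset.sum_Ico_sub R h]

lemma usum_eq_pairForm {a b : ℕ} (h : a ≤ b + 1) : usum a b = pairForm (a, b + 1) := by
  rw [usum, pairForm, ← sum_Icc_sub_of_le partialSum h]
  refine Finset.sum_congr rfl fun k _ => ?_
  simp [partialSum, Finset.sum_range_succ]

lemma u_eq_pairForm (k : ℕ) : u k = pairForm (k, k + 1) := by
  simp [pairForm, partialSum, Finset.sum_range_succ]

/-- the linear forms `u_{i..j}` in the polynomial ring. -/
def linearForm (i j : ℕ) : MPoly := ∑ k ∈ Finset.Icc i j, X k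

/-- the polynomial `H_n`. -/
def hPoly (n : ℕ) : MPoly := ∏ i ∈ Finset.Icc 1 n, ∏ j ∈ Finset.Icc i n, linearForm i j

lemma algebraMap_linearForm (i j : ℕ) : algebraMap MPoly K (linearForm i j) = usum i j := by
  simp [linearForm, usum, u]

lemma algebraMap_hPoly (n : ℕ) : algebraMap MPoly K (hPoly n) = Hprod n := by
  simp [hPoly, Hprod, algebraMap_linearForm]

lemma linearForm_ne_zero {i j : ℕ} (h : i ≤ j) : linearForm i j ≠ 0 := by
  intro h0
  have h1 := congrArg (MvPolynomial.eval (fun _ : ℕ => (1 : ℚ))) h0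
  simp only [linearForm, map_sum, eval_X, Finset.sum_const, Nat.card_Icc, nsmul_eq_mul, mul_one,
    map_zero, Nat.cast_eq_zero] at h1
  omega

lemma usum_ne_zero {i j : ℕ} (h : i ≤ j) : usum i j ≠ 0 := by
  rw [← algebraMap_linearForm]
  exact (map_ne_zero_iff _ (IsFractionRing.injective MPoly K)).2 (linearForm_ne_zero h)

lemma pairForm_ne_zero {p : ℕ × ℕ} (h : p.1 < p.2) : pairForm p ≠ 0 := by
  obtain ⟨x, y⟩ := p
  obtain ⟨y, rfl⟩ : ∃ z, y = z + 1 := ⟨y - 1, by simp at h; omega⟩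
  rw [← usum_eq_pairForm (by simp at h; omega)]
  exact usum_ne_zero (by simp at h; omega)

lemma prod_Icc_eq_prod_orderedPairs (n : ℕ) (F : ℕ × ℕ → K) :
    ∏ i ∈ Finset.Icc 1 n, ∏ j ∈ Finset.Icc i n, F (i, j + 1) = ∏ p ∈ orderedPairs n, F p := by
  rw [Finset.prod_sigma']
  refine Finset.prod_bij' (fun s _ => (s.1, s.2 + 1)) (fun p _ => ⟨p.1, p.2 - 1⟩) ?_ ?_ ?_ ?_ ?_
  · rintro ⟨a, b⟩ h
    simp only [Finset.mem_sigma, Finset.mem_Icc] at h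
    simp only [mem_orderedPairs]
    omega
  · rintro ⟨a, b⟩ h
    simp only [mem_orderedPairs] at h
    simp only [Finset.mem_sigma, Finset.mem_Icc]
    omega
  · rintro ⟨a, b⟩ h
    rfl
  · rintro ⟨a, b⟩ h
    simp only [mem_orderedPairs] at h
    simp only [Prod.mk.injEq, true_and]
    omega
  · rintro ⟨a, b⟩ h
    rfl

lemma Hprod_eq_prod_orderedPairs (n : ℕ) : Hprod n = ∏ p ∈ orderedPairs n, pairForm p := by
  rw [← prod_Icc_eq_prod_orderedPairs, Hprod]
  refine Finset.prod_congr rfl fun i _ => Finset.prod_congr rfl fun j hj => ?_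
  rw [Finset.mem_Icc] at hj
  exact usum_eq_pairForm (by omega)

lemma Hprod_ne_zero (n : ℕ) : Hprod n ≠ 0 := by
  rw [Hprod_eq_prod_orderedPairs]
  exact Finset.prod_ne_zero_iff.2 fun p hp => pairForm_ne_zero (mem_orderedPairs.1 hp).2.1

lemma pev_X (v : ℕ → K) (k : ℕ) : pev v (X k) = v k := by
  simp [pev]

lemma pev_hPoly {n : ℕ} {v : ℕ → K} {ψ : ℕ → ℕ}
    (hv : ∀ k, 1 ≤ k → k ≤ n → v k = pairForm (ψ k, ψ (k + 1))) :
    pev v (hPoly n) = ∏ p ∈ orderedPairs n, pairForm (ψ p.1, ψ p.2) := by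
  rw [← prod_Icc_eq_prod_orderedPairs n (fun p => pairForm (ψ p.1, ψ p.2))]
  simp only [hPoly, linearForm, map_prod, map_sum, pev_X]
  refine Finset.prod_congr rfl fun i hi => Finset.prod_congr rfl fun j hj => ?_
  rw [Finset.mem_Icc] at hi hj
  simp only [pairForm]
  rw [← sum_Icc_sub_of_le (fun k => partialSum (ψ k)) (by omega)]
  refine Finset.sum_congr rfl fun k hk => ?_
  rw [Finset.mem_Icc] at hk
  exact hv k (by omega) (by omega)

lemma msub_div {v : ℕ → K} {p q : MPoly} (hq : pev v q ≠ 0) :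
    msub v (algebraMap MPoly K p / algebraMap MPoly K q) = pev v p / pev v q := by
  have hq0 : q ≠ 0 := by
    rintro rfl
    simp at hq
  have hex : ∃ w : K, ∃ p' q' : MPoly, q' ≠ 0 ∧
      algebraMap MPoly K p / algebraMap MPoly K q =
        algebraMap MPoly K p' / algebraMap MPoly K q' ∧
      pev v q' ≠ 0 ∧ w = pev v p' / pev v q' := ⟨_, p, q, hq0, rfl, hq, rfl⟩
  rw [msub, dif_pos hex]
  obtain ⟨p', q', hq0', heq, hq', hw⟩ := hex.choose_spec
  rw [hw, div_eq_div_iff hq' hq, ← map_mul, ← map_mul]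
  have hinj := IsFractionRing.injective MPoly K
  rw [div_eq_div_iff ((map_ne_zero_iff _ hinj).2 hq0) ((map_ne_zero_iff _ hinj).2 hq0'),
    ← map_mul, ← map_mul] at heq
  rw [hinj heq]

/-- the subring of `K` of polynomials in `u_1, …, u_n`. -/
def polySubring (n : ℕ) : Subring K :=
  (supported ℚ (Set.Icc 1 n)).toSubring.map (algebraMap MPoly K)

lemma isPolyIn_iff_mem {n : ℕ} {x : K} : IsPolyIn n x ↔ x ∈ polySubring n := by
  simp only [IsPolyIn, polySubring, Subring.mem_map, Subalgebra.mem_toSubring, mem_supported,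
    Set.subset_def, Finset.mem_coe, Set.mem_Icc, eq_comm]

lemma u_mem {n k : ℕ} (h1 : 1 ≤ k) (h2 : k ≤ n) : u k ∈ polySubring n :=
  isPolyIn_iff_mem.1 ⟨X k, by simp [vars_X, h1, h2], rfl⟩

lemma usum_mem {n i j : ℕ} (h1 : 1 ≤ i) (h2 : j ≤ n) : usum i j ∈ polySubring n :=
  sum_mem fun k hk => by
    rw [Finset.mem_Icc] at hk
    exact u_mem (by omega) (by omega)

lemma pairForm_mem {n : ℕ} {p : ℕ × ℕ} (hp : p ∈ orderedPairs n) :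
    pairForm p ∈ polySubring n := by
  obtain ⟨x, y⟩ := p
  rw [mem_orderedPairs] at hp
  obtain ⟨z, rfl⟩ : ∃ z, y = z + 1 := ⟨y - 1, by simp at hp; omega⟩
  simp only at hp
  rw [← usum_eq_pairForm (by omega)]
  exact usum_mem (by omega) (by omega)

lemma pev_mem {n : ℕ} {v : ℕ → K} {P : MPoly} (hv : ∀ k ∈ P.vars, v k ∈ polySubring n) :
    pev v P ∈ polySubring n := by
  rw [pev, coe_eval₂Hom, eval₂_eq]
  refine sum_mem fun d hd => mul_mem ?_ (prod_mem fun i hi => pow_mem (hv i ?_) _)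
  · exact isPolyIn_iff_mem.1 ⟨C (P.coeff d), by simp [vars_C], rfl⟩
  · exact (mem_vars_iff_mem_support i).2 ⟨d, hd, hi⟩

/-- Substitution into `f = P / H_m` when the substituted values are differences of partial sums. -/
lemma msub_of_isPolyIn {m N : ℕ} {f : K} {v : ℕ → K} {ψ : ℕ → ℕ}
    (hf : IsPolyIn m (Hprod m * f))
    (hv : ∀ k, 1 ≤ k → k ≤ m → v k = pairForm (ψ k, ψ (k + 1)))
    (hmem : ∀ k, 1 ≤ k → k ≤ m → v k ∈ polySubring N)
    (hne : ∏ p ∈ orderedPairs m, pairForm (ψ p.1, ψ p.2) ≠ 0) :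
    ∃ x ∈ polySubring N,
      msub v f = x / ∏ p ∈ orderedPairs m, pairForm (ψ p.1, ψ p.2) := by
  obtain ⟨P, hP, hPf⟩ := hf
  have hfeq : f = algebraMap MPoly K P / algebraMap MPoly K (hPoly m) := by
    rw [algebraMap_hPoly, ← hPf, mul_div_cancel_left₀ _ (Hprod_ne_zero m)]
  refine ⟨pev v P, pev_mem fun k hk => hmem k (hP k hk).1 (hP k hk).2, ?_⟩
  rw [hfeq, msub_div (by rwa [pev_hPoly hv]), pev_hPoly hv]

lemma isPolyIn_Hprod_mul_comp {m n i : ℕ} {f g : K} (hn : 1 ≤ n)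
    (hf : IsPolyIn m (Hprod m * f)) (hg : IsPolyIn n (Hprod n * g))
    (hi : 1 ≤ i) (him : i ≤ m) :
    IsPolyIn (m + n - 1) (Hprod (m + n - 1) * comp n i f g) := by
  set φ : ℕ → ℕ := fun k => if k ≤ i then k else k + n - 1 with hφ
  set χ : ℕ → ℕ := fun k => k + i - 1 with hχ
  have hprodφ : ∏ p ∈ orderedPairs m, pairForm (φ p.1, φ p.2) =
      ∏ p ∈ (orderedPairs m).image (Prod.map φ φ), pairForm p := by
    rw [Finset.prod_image]
    · rfl
    · rintro ⟨a, b⟩ ha ⟨c, d⟩ hc h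
      simp only [Prod.map, Prod.mk.injEq, hφ] at h ⊢
      constructor <;> grind
  have hprodχ : ∏ p ∈ orderedPairs n, pairForm (χ p.1, χ p.2) =
      ∏ p ∈ (orderedPairs n).image (Prod.map χ χ), pairForm p := by
    rw [Finset.prod_image]
    · rfl
    · rintro ⟨a, b⟩ ha ⟨c, d⟩ hc h
      simp only [Prod.map, Prod.mk.injEq, hχ] at h ⊢
      omega
  set A := (orderedPairs m).image (Prod.map φ φ) with hA
  set B := (orderedPairs n).image (Prod.map χ χ) with hB
  have hAsub : A ⊆ orderedPairs (m + n - 1) := by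
    intro q hq
    obtain ⟨⟨a, b⟩, hp, rfl⟩ := Finset.mem_image.1 hq
    simp only [mem_orderedPairs, Prod.map, hφ] at hp ⊢
    grind
  have hBsub : B ⊆ orderedPairs (m + n - 1) := by
    intro q hq
    obtain ⟨⟨a, b⟩, hp, rfl⟩ := Finset.mem_image.1 hq
    simp only [mem_orderedPairs, Prod.map, hχ] at hp ⊢
    omega
  have hAB : A ∩ B = {(i, i + n)} := by
    ext ⟨x, y⟩
    simp only [hA, hB, Finset.mem_inter, Finset.mem_image, mem_orderedPairs, Prod.map,
      Prod.mk.injEq, Finset.mem_singleton, Prod.exists]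
    constructor
    · rintro ⟨⟨a, b, hab, ha, hb⟩, ⟨c, d, hcd, hc, hd⟩⟩
      simp only [hφ, hχ] at ha hb hc hd
      constructor <;> grind
    · rintro ⟨rfl, rfl⟩
      refine ⟨⟨x, x + 1, by omega, ?_, ?_⟩, ⟨1, n + 1, by omega, ?_, ?_⟩⟩ <;>
        simp only [hφ, hχ] <;> grind
  have hne : ∀ C ⊆ orderedPairs (m + n - 1), ∏ p ∈ C, pairForm p ≠ 0 := fun C hC =>
    Finset.prod_ne_zero_iff.2 fun p hp => pairForm_ne_zero (mem_orderedPairs.1 (hC hp)).2.1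
  have hF : ∀ k, 1 ≤ k → k ≤ m → compSubF n i k = pairForm (φ k, φ (k + 1)) ∧
      compSubF n i k ∈ polySubring (m + n - 1) := by
    intro k hk hkm
    simp only [compSubF, hφ]
    rcases lt_trichotomy k i with h | rfl | h
    · rw [if_pos h, if_pos h.le, if_pos (by omega)]
      exact ⟨u_eq_pairForm k, u_mem (by omega) (by omega)⟩
    · rw [if_neg (lt_irrefl _), if_pos rfl, if_pos le_rfl, if_neg (by omega),
        show k + 1 + n - 1 = k + n - 1 + 1 by omega]
      exact ⟨usum_eq_pairForm (by omega), usum_mem (by omega) (by omega)⟩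
    · rw [if_neg (by omega), if_neg (by omega), if_neg (by omega), if_neg (by omega),
        show k + 1 + n - 1 = k + n - 1 + 1 by omega]
      exact ⟨u_eq_pairForm _, u_mem (by omega) (by omega)⟩
  have hG : ∀ k, 1 ≤ k → k ≤ n → compSubG i k = pairForm (χ k, χ (k + 1)) ∧
      compSubG i k ∈ polySubring (m + n - 1) := by
    intro k hk hkn
    simp only [compSubG, hχ]
    rw [show k + 1 + i - 1 = k + i - 1 + 1 by omega]
    exact ⟨u_eq_pairForm _, u_mem (by omega) (by omega)⟩
  obtain ⟨x, hx, hfx⟩ := msub_of_isPolyIn hf (fun k h1 h2 => (hF k h1 h2).1)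
    (fun k h1 h2 => (hF k h1 h2).2) (hprodφ ▸ hne A hAsub)
  obtain ⟨y, hy, hgy⟩ := msub_of_isPolyIn hg (fun k h1 h2 => (hG k h1 h2).1)
    (fun k h1 h2 => (hG k h1 h2).2) (hprodχ ▸ hne B hBsub)
  have husum : usum i (i + n - 1) = ∏ p ∈ A ∩ B, pairForm p := by
    rw [hAB, Finset.prod_singleton, usum_eq_pairForm (by omega),
      show i + n - 1 + 1 = i + n by omega]
  have hunion : (∏ p ∈ A ∪ B, pairForm p) * ∏ p ∈ A ∩ B, pairForm p =
      (∏ p ∈ A, pairForm p) * ∏ p ∈ B, pairForm p := Finset.prod_union_inter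
  have hkey : Hprod (m + n - 1) * comp n i f g =
      (∏ p ∈ orderedPairs (m + n - 1) \ (A ∪ B), pairForm p) * x * y := by
    rw [comp, hfx, hgy, hprodφ, hprodχ, husum, Hprod_eq_prod_orderedPairs,
      ← Finset.prod_sdiff (Finset.union_subset hAsub hBsub)]
    have hA0 := hne A hAsub
    have hB0 := hne B hBsub
    field_simp
    linear_combination
      (∏ p ∈ orderedPairs (m + n - 1) \ (A ∪ B), pairForm p) * x * y * hunion
  rw [isPolyIn_iff_mem, hkey]
  exact mul_mem (mul_mem (prod_mem fun p hp => pairForm_mem (Finset.sdiff_subset hp)) hx) hy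

lemma prod_push_pairForm (m : ℕ) :
    ∏ p ∈ orderedPairs m, pairForm
        (if p.1 = 1 then m + 1 else p.1 - 1, if p.2 = 1 then m + 1 else p.2 - 1) =
      (∏ p ∈ orderedPairs m, if p.1 = 1 then (-1 : K) else 1) * Hprod m := by
  have hbij : Hprod m = ∏ p ∈ orderedPairs m,
      pairForm (if p.1 = 1 then (p.2 - 1, m + 1) else (p.1 - 1, p.2 - 1)) := by
    rw [Hprod_eq_prod_orderedPairs]
    symm
    refine Finset.prod_bij'
      (fun p _ => if p.1 = 1 then (p.2 - 1, m + 1) else (p.1 - 1, p.2 - 1))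
      (fun p _ => if p.2 = m + 1 then (1, p.1 + 1) else (p.1 + 1, p.2 + 1)) ?_ ?_ ?_ ?_ ?_
    · rintro ⟨a, b⟩ h
      simp only [mem_orderedPairs] at h ⊢
      grind
    · rintro ⟨a, b⟩ h
      simp only [mem_orderedPairs] at h ⊢
      grind
    · rintro ⟨a, b⟩ h
      simp only [mem_orderedPairs] at h ⊢
      grind
    · rintro ⟨a, b⟩ h
      simp only [mem_orderedPairs] at h ⊢
      grind
    · rintro ⟨a, b⟩ h
      rfl
  rw [hbij, ← Finset.prod_mul_distrib]
  refine Finset.prod_congr rfl fun p hp => ?_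
  rw [mem_orderedPairs] at hp
  have h2 : p.2 ≠ 1 := by omega
  by_cases h1 : p.1 = 1
  · simp [h1, h2, pairForm]
  · simp [h1, h2]

lemma isPolyIn_Hprod_mul_push {m : ℕ} {f : K} (hf : IsPolyIn m (Hprod m * f)) :
    IsPolyIn m (Hprod m * push m f) := by
  set ε : K := ∏ p ∈ orderedPairs m, if p.1 = 1 then (-1 : K) else 1 with hε
  have hε2 : ε * ε = 1 := by
    rw [hε, ← Finset.prod_mul_distrib]
    refine Finset.prod_eq_one fun p _ => ?_
    split_ifs <;> norm_num
  have hε0 : ε ≠ 0 := left_ne_zero_of_mul_eq_one hε2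
  have hεmem : ε ∈ polySubring m := prod_mem fun p _ => by
    split_ifs
    · exact neg_mem (one_mem _)
    · exact one_mem _
  have hH := Hprod_ne_zero m
  have hv : ∀ k, 1 ≤ k → k ≤ m →
      (if k = 1 then -(usum 1 m) else if k ≤ m then u (k - 1) else u k) =
        pairForm ((fun j => if j = 1 then m + 1 else j - 1) k,
          (fun j => if j = 1 then m + 1 else j - 1) (k + 1)) ∧
      (if k = 1 then -(usum 1 m) else if k ≤ m then u (k - 1) else u k) ∈ polySubring m := by
    intro k hk hkm
    by_cases h : k = 1
    · subst h
      refine ⟨?_, ?_⟩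
      · simp [usum_eq_pairForm, pairForm]
      · simpa using usum_mem le_rfl le_rfl
    · refine ⟨?_, ?_⟩
      · obtain ⟨l, rfl⟩ : ∃ l, k = l + 1 := ⟨k - 1, by omega⟩
        simp only [h, hkm, if_true, if_false, Nat.add_sub_cancel, u_eq_pairForm l]
        rw [if_neg (by omega)]
      · simp only [h, hkm, if_true, if_false]
        exact u_mem (by omega) (by omega)
  obtain ⟨x, hx, hfx⟩ := msub_of_isPolyIn hf (fun k h1 h2 => (hv k h1 h2).1)
    (fun k h1 h2 => (hv k h1 h2).2)
    (by rw [prod_push_pairForm]; exact mul_ne_zero hε0 hH)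
  have hkey : Hprod m * push m f = x * ε := by
    rw [push, hfx, prod_push_pairForm, ← hε]
    field_simp
    linear_combination -x * hε2
  rw [isPolyIn_iff_mem, hkey]
  exact mul_mem hx hεmem

/-- if `H_m·f` and `H_n·g` are polynomials, then so is
`H_{m+n-1}·(f ∘_i g)` for every `1 ≤ i ≤ m`; moreover `H_m·τ(f)` is a
polynomial as well. -/
theorem hprod_comp_push (m n : ℕ) (hm : 1 ≤ m) (hn : 1 ≤ n)
    (f g : K) (hf : f ∈ Mould m) (hg : g ∈ Mould n)
    (hfp : IsPolyIn m (Hprod m * f)) (hgp : IsPolyIn n (Hprod n * g)) :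
    (∀ i : ℕ, 1 ≤ i → i ≤ m →
        IsPolyIn (m + n - 1) (Hprod (m + n - 1) * comp n i f g)) ∧
      IsPolyIn m (Hprod m * push m f) := by
  exact ⟨fun i hi him => isPolyIn_Hprod_mul_comp hn hfp hgp hi him,
    isPolyIn_Hprod_mul_push hfp⟩

end MouldOperad
end
end
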